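/- Let n ≥ 1, s ∈ ℝ and 1 ≤ p ≤ ∞. Then there exists a constant C > 0 such that ‖e^{iΔ}f‖_{W_{p,p}} ≤ C‖f‖_{W^s_{p,p}} for all f ∈ 𝒮(ℝⁿ) if and only if s ≥ 0. -/

import Mathlib

open MeasureTheory Real
open scoped ENNReal RealInnerProductSpace

noncomputable section

/-- The short-time Fourier transform
`V_g f (x, ξ) = ∫ e^{-i ξ·t} conj (g (t - x)) f t dt`. -/
def STFT {n : ℕ} (g f : EuclideanSpace ℝ (Fin n) → ℂ)
    (x ξ : EuclideanSpace ℝ (Fin n)) : ℂ :=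
  ∫ t : EuclideanSpace ℝ (Fin n),
    Complex.exp (-(Complex.I * Complex.ofReal ⟪ξ, t⟫)) * (starRingEnd ℂ) (g (t - x)) * f t

/-- The Fourier transform `f̂ (ξ) = ∫ e^{-i ξ·x} f x dx`. -/
def FT {n : ℕ} (f : EuclideanSpace ℝ (Fin n) → ℂ) (ξ : EuclideanSpace ℝ (Fin n)) : ℂ :=
  ∫ x : EuclideanSpace ℝ (Fin n),
    Complex.exp (-(Complex.I * Complex.ofReal ⟪ξ, x⟫)) * f x

/-- The power of the Japanese bracket `⟨x⟩ˢ = (1 + |x|²)^(s/2)`. -/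
def jp {n : ℕ} (s : ℝ) (x : EuclideanSpace ℝ (Fin n)) : ℝ := (1 + ‖x‖ ^ 2) ^ (s / 2)

/-- The Gaussian window `g₀ (t) = e^{-|t|²}`. -/
def gauss {n : ℕ} (t : EuclideanSpace ℝ (Fin n)) : ℂ := Complex.ofReal (Real.exp (-‖t‖ ^ 2))

/-- The `L^p` norm (valued in `ℝ≥0∞`) of an `ℝ≥0∞`-valued function. -/
def lpN {n : ℕ} (p : ℝ≥0∞) (F : EuclideanSpace ℝ (Fin n) → ℝ≥0∞) : ℝ≥0∞ :=
  if p = ∞ then essSup F volume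
  else (∫⁻ x, F x ^ p.toReal) ^ p.toReal⁻¹

/-- The Wiener amalgam space norm `‖f‖_{W^s_{p,q}}`:
inner `L^q` norm in the frequency variable ξ, outer `L^p` norm in the space variable x,
with the Gaussian window. -/
def WNorm {n : ℕ} (s : ℝ) (p q : ℝ≥0∞) (f : EuclideanSpace ℝ (Fin n) → ℂ) : ℝ≥0∞ :=
  lpN p (fun x => lpN q (fun ξ => ENNReal.ofReal (jp s ξ) * (‖STFT gauss f x ξ‖₊ : ℝ≥0∞)))

/-- The modulation space norm `‖f‖_{M^s_{p,q}}`: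
inner `L^p` norm in the space variable x, outer `L^q` norm in the frequency variable ξ,
with the Gaussian window. -/
def MNorm {n : ℕ} (s : ℝ) (p q : ℝ≥0∞) (f : EuclideanSpace ℝ (Fin n) → ℂ) : ℝ≥0∞ :=
  lpN q (fun ξ => lpN p (fun x => ENNReal.ofReal (jp s ξ) * (‖STFT gauss f x ξ‖₊ : ℝ≥0∞)))

/-- The Schrödinger operator `e^{iεΔ} f = ℱ⁻¹ [ξ ↦ e^{-iε|ξ|²} f̂ (ξ)]` (`ε = ±1`). -/
def schrod {n : ℕ} (ε : ℝ) (f : EuclideanSpace ℝ (Fin n) → ℂ)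
    (x : EuclideanSpace ℝ (Fin n)) : ℂ :=
  (((2 * Real.pi) ^ n)⁻¹ : ℝ) *
    ∫ ξ : EuclideanSpace ℝ (Fin n),
      Complex.exp (Complex.I * Complex.ofReal ⟪x, ξ⟫) *
        Complex.exp (-(Complex.ofReal ε * Complex.I * Complex.ofReal (‖ξ‖ ^ 2))) * FT f ξ

/-- The lattice point `k ∈ ℤⁿ` viewed as a point of `ℝⁿ`. -/
def zlift {n : ℕ} (k : Fin n → ℤ) : EuclideanSpace ℝ (Fin n) :=
  (WithLp.equiv 2 (Fin n → ℝ)).symm fun i => (k i : ℝ)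

/-- For equal exponents, the iterated Lebesgue norm is the norm on the product space. -/
theorem lpN_lpN_eq_eLpNorm_prod {n : ℕ} {p : ℝ≥0∞} (hp : 1 ≤ p)
    {F : EuclideanSpace ℝ (Fin n) × EuclideanSpace ℝ (Fin n) → ℝ≥0∞} (hF : Measurable F) :
    lpN p (fun x => lpN p fun ξ => F (x, ξ)) = eLpNorm F p volume := by
  by_cases h : p = ∞
  · subst h
    simp only [lpN, if_true, eLpNorm_exponent_top, eLpNormEssSup, enorm_eq_self]
    have essSup_le_iff {α : Type} [MeasurableSpace α] (μ : Measure α) (G : α → ℝ≥0∞) (c : ℝ≥0∞) :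
        essSup G μ ≤ c ↔ ∀ᵐ x ∂μ, G x ≤ c :=
      ⟨fun hc => (ENNReal.ae_le_essSup G).mono fun x hx => hx.trans hc,
        fun hc => essSup_le_of_ae_le c hc⟩
    refine eq_of_forall_ge_iff fun c => ?_
    simp only [essSup_le_iff]
    exact (Measure.ae_prod_iff_ae_ae (measurableSet_le hF measurable_const)).symm
  · have hp0 : p.toReal ≠ 0 := (ENNReal.toReal_pos (by positivity) h).ne'
    rw [eLpNorm_eq_lintegral_rpow_enorm_toReal (by positivity) h]
    simp only [lpN, if_neg h, enorm_eq_self, one_div]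
    simp only [← ENNReal.rpow_mul, inv_mul_cancel₀ hp0, ENNReal.rpow_one]
    rw [Measure.volume_eq_prod, lintegral_prod _ (hF.pow_const _).aemeasurable]

/-- Young's inequality `‖K ∗ F‖_p ≤ ‖K‖_1 ‖F‖_p` for nonnegative functions. -/
theorem eLpNorm_lintegral_mul_add_le {G : Type*} [AddCommGroup G] [MeasurableSpace G]
    [MeasurableAdd₂ G] (μ : Measure G) [SFinite μ] [μ.IsAddLeftInvariant]
    {K F : G → ℝ≥0∞} (hK : Measurable K) (hF : Measurable F) {p : ℝ≥0∞} (hp : 1 ≤ p) :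
    eLpNorm (fun z => ∫⁻ w, K w * F (z + w) ∂μ) p μ ≤ (∫⁻ w, K w ∂μ) * eLpNorm F p μ := by
  by_cases h : p = ∞
  · subst h
    simp only [eLpNorm_exponent_top, eLpNormEssSup, enorm_eq_self]
    refine essSup_le_of_ae_le _ (.of_forall fun z => ?_)
    have hae : ∀ᵐ w ∂μ, F (z + w) ≤ essSup F μ :=
      (measurePreserving_add_left μ z).quasiMeasurePreserving.ae (ENNReal.ae_le_essSup F)
    rw [← lintegral_mul_const _ hK]
    refine lintegral_mono_ae (hae.mono fun w hw => ?_)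
    gcongr
  · have hp1 : 1 ≤ p.toReal := by simpa using ENNReal.toReal_mono h hp
    have hp0 : 0 < p.toReal := by linarith
    rw [eLpNorm_eq_lintegral_rpow_enorm_toReal (by positivity) h,
      eLpNorm_eq_lintegral_rpow_enorm_toReal (by positivity) h]
    simp only [enorm_eq_self, one_div]
    set r := p.toReal
    have hpt (z : G) : (∫⁻ w, K w * F (z + w) ∂μ) ^ r
        ≤ (∫⁻ w, K w ∂μ) ^ (r - 1) * ∫⁻ w, K w * F (z + w) ^ r ∂μ := by
      have hm : Measurable fun w => K w * F (z + w) ^ r :=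
        hK.mul ((hF.comp (measurable_const_add z)).pow_const r)
      have key := ENNReal.lintegral_mul_norm_pow_le (μ := μ) (p := 1 - r⁻¹) (q := r⁻¹)
        hK.aemeasurable hm.aemeasurable (by simpa using inv_le_one_of_one_le₀ hp1)
        (by positivity) (by ring)
      have e (w : G) : K w ^ (1 - r⁻¹) * (K w * F (z + w) ^ r) ^ r⁻¹ = K w * F (z + w) := by
        rw [ENNReal.mul_rpow_of_nonneg _ _ (by positivity), ENNReal.rpow_rpow_inv hp0.ne',
          ← mul_assoc, ← ENNReal.rpow_add_of_nonneg _ _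
            (by simpa using inv_le_one_of_one_le₀ hp1) (by positivity)]
        simp
      simp only [e] at key
      calc _ ≤ ((∫⁻ w, K w ∂μ) ^ (1 - r⁻¹) * (∫⁻ w, K w * F (z + w) ^ r ∂μ) ^ r⁻¹) ^ r := by
            gcongr
        _ = _ := by
          rw [ENNReal.mul_rpow_of_nonneg _ _ hp0.le, ENNReal.rpow_inv_rpow hp0.ne',
            ← ENNReal.rpow_mul]
          congr 2
          field_simp
    have htr (w : G) : ∫⁻ z, F (z + w) ^ r ∂μ = ∫⁻ z, F z ^ r ∂μ := by
      simp_rw [add_comm _ w]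
      exact lintegral_add_left_eq_self (fun z => F z ^ r) w
    have hsw : ∫⁻ z, ∫⁻ w, K w * F (z + w) ^ r ∂μ ∂μ = (∫⁻ w, K w ∂μ) * ∫⁻ z, F z ^ r ∂μ := by
      rw [lintegral_lintegral_swap]
      · rw [← lintegral_mul_const _ hK]
        refine lintegral_congr fun w => ?_
        rw [← htr w]
        exact lintegral_const_mul _ ((hF.comp (measurable_add_const w)).pow_const r)
      · exact ((hK.comp measurable_snd).mul
          ((hF.comp (measurable_fst.add measurable_snd)).pow_const r)).aemeasurable
    have hm2 : Measurable fun z => ∫⁻ w, K w * F (z + w) ^ r ∂μ :=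
      Measurable.lintegral_prod_right ((hK.comp measurable_snd).mul
          ((hF.comp (measurable_fst.add measurable_snd)).pow_const r))
    calc _ ≤ (∫⁻ z, (∫⁻ w, K w ∂μ) ^ (r - 1) * ∫⁻ w, K w * F (z + w) ^ r ∂μ ∂μ) ^ r⁻¹ := by
          gcongr with z
          exact hpt z
      _ = ((∫⁻ w, K w ∂μ) ^ r * ∫⁻ z, F z ^ r ∂μ) ^ r⁻¹ := by
          rw [lintegral_const_mul _ hm2, hsw, ← mul_assoc]
          congr 2
          nth_rw 2 [← ENNReal.rpow_one (∫⁻ w, K w ∂μ)]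
          rw [← ENNReal.rpow_add_of_nonneg _ _ (by linarith) zero_le_one]
          simp
      _ = _ := by
          rw [ENNReal.mul_rpow_of_nonneg _ _ (by positivity), ENNReal.rpow_rpow_inv hp0.ne']

/-- Fubini's theorem for a product of two integrable functions and a bounded kernel. -/
theorem integral_mul_integral_swap {X Y : Type*} [TopologicalSpace X] [TopologicalSpace Y]
    [SecondCountableTopology X] [SecondCountableTopology Y]
    [MeasurableSpace X] [MeasurableSpace Y] [BorelSpace X] [BorelSpace Y]
    {μ : Measure X} {ν : Measure Y} [SFinite μ] [SFinite ν] {f : X → ℂ} {h : Y → ℂ}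
    (hf : Integrable f μ) (hh : Integrable h ν) {φ : X → Y → ℂ}
    (hφ : Continuous fun z : X × Y => φ z.1 z.2) (hb : ∀ x y, ‖φ x y‖ ≤ 1) :
    ∫ x, f x * ∫ y, φ x y * h y ∂ν ∂μ = ∫ y, h y * ∫ x, φ x y * f x ∂μ ∂ν := by
  simp_rw [← integral_const_mul]
  rw [integral_integral_swap]
  · congr! 4
    ring
  · refine ((hf.mul_prod hh).bdd_mul (c := 1) hφ.aestronglyMeasurable
      (.of_forall fun z => hb z.1 z.2)).congr (.of_forall fun z => ?_)
    simp only [Function.uncurry]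
    ring

theorem integrable_cexp_neg_mul_sq_norm {V : Type*} [NormedAddCommGroup V] [InnerProductSpace ℝ V]
    [FiniteDimensional ℝ V] [MeasurableSpace V] [BorelSpace V] {b : ℂ} (hb : 0 < b.re) :
    Integrable fun v : V => Complex.exp (-b * ‖v‖ ^ 2) := by
  simpa using GaussianFourier.integrable_cexp_neg_mul_sq_norm_add hb 0 (0 : V)

/-- The Gaussian `exp (-‖x‖²)` as a Schwartz function. -/
def schwartzGaussian (V : Type*) [NormedAddCommGroup V] [InnerProductSpace ℝ V] :
    SchwartzMap V ℝ where
  toFun x := Real.exp (-‖x‖ ^ 2)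
  smooth' := Real.contDiff_exp.comp (contDiff_norm_sq ℝ).neg
  decay' := by
    intro k m
    have hT : Function.HasTemperateGrowth fun x : V => -‖x‖ ^ 2 :=
      (Function.hasTemperateGrowth_norm_sq V).neg
    obtain ⟨K, C, hC, hb⟩ := hT.norm_iteratedFDeriv_le_uniform m
    obtain ⟨B, hB⟩ : ∃ B : ℝ, ∀ r : ℝ, 0 ≤ r → (1 + r) ^ (k + K * m) * Real.exp (-r ^ 2) ≤ B := by
      set N := k + K * m
      refine ⟨N.factorial * Real.exp 2, fun r hr => ?_⟩
      have h1 : (1 + r) ^ N ≤ N.factorial * Real.exp (1 + r) := by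
        have := Real.pow_div_factorial_le_exp (1 + r) (by positivity) N
        rwa [div_le_iff₀' (by positivity)] at this
      calc (1 + r) ^ N * Real.exp (-r ^ 2)
          ≤ N.factorial * Real.exp (1 + r) * Real.exp (-r ^ 2) := by gcongr
        _ = N.factorial * Real.exp (1 + r + -r ^ 2) := by rw [mul_assoc, ← Real.exp_add]
        _ ≤ _ := by
          gcongr
          nlinarith [sq_nonneg (r - 1 / 2)]
    refine ⟨m.factorial * (1 + C) ^ m * B, fun x => ?_⟩
    have h1 : 1 ≤ (1 + C) * (1 + ‖x‖) ^ K :=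
      one_le_mul_of_one_le_of_one_le (by linarith) (one_le_pow₀ (by simp))
    have hcomp := norm_iteratedFDeriv_comp_le (𝕜 := ℝ) (g := Real.exp)
      (f := fun x : V => -‖x‖ ^ 2) (n := m) (N := m) Real.contDiff_exp (contDiff_norm_sq ℝ).neg
      le_rfl x (C := Real.exp (-‖x‖ ^ 2)) (D := (1 + C) * (1 + ‖x‖) ^ K)
      (fun i _ => by
        rw [norm_iteratedFDeriv_eq_norm_iteratedDeriv, iteratedDeriv_eq_iterate, Real.iter_deriv_exp]
        simp)
      (fun i hi him => by
        refine (hb i him x).trans (le_trans ?_ (le_self_pow₀ h1 (by omega)))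
        gcongr
        linarith)
    calc ‖x‖ ^ k * ‖iteratedFDeriv ℝ m (Real.exp ∘ fun x : V => -‖x‖ ^ 2) x‖
        ≤ (1 + ‖x‖) ^ k * (m.factorial * Real.exp (-‖x‖ ^ 2) * ((1 + C) * (1 + ‖x‖) ^ K) ^ m) := by
          gcongr
          linarith
      _ = m.factorial * (1 + C) ^ m * ((1 + ‖x‖) ^ (k + K * m) * Real.exp (-‖x‖ ^ 2)) := by
          rw [mul_pow, ← pow_mul, pow_add]
          ring
      _ ≤ _ := by
          gcongr
          exact hB _ (norm_nonneg x)

theorem schwartzGaussian_apply {V : Type*} [NormedAddCommGroup V] [InnerProductSpace ℝ V] (x : V) :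
    schwartzGaussian V x = Real.exp (-‖x‖ ^ 2) := rfl

theorem hasTemperateGrowth_cexp_I_mul :
    Function.HasTemperateGrowth fun x : ℝ => Complex.exp (Complex.I * x) := by
  have hd : ∀ m : ℕ, iteratedDeriv m (fun x : ℝ => Complex.exp (Complex.I * x))
      = fun x : ℝ => Complex.I ^ m * Complex.exp (Complex.I * x) := by
    intro m
    induction m with
    | zero => simp
    | succ m ih =>
      rw [iteratedDeriv_succ, ih]
      funext x
      have h : HasDerivAt (fun x : ℝ => Complex.exp (Complex.I * x))
          (Complex.exp (Complex.I * x) * (Complex.I * 1)) x :=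
        ((Complex.ofRealCLM.hasDerivAt).const_mul Complex.I).cexp
      rw [(h.const_mul (Complex.I ^ m)).deriv]
      ring
  refine ⟨Complex.contDiff_exp.comp (contDiff_const.mul Complex.ofRealCLM.contDiff),
    fun m => ⟨0, 1, fun x => ?_⟩⟩
  rw [norm_iteratedFDeriv_eq_norm_iteratedDeriv, hd]
  simp [Complex.norm_exp]

/-- The modulated Gaussian `exp (i⟪N, x⟫) exp (-‖x‖²)` as a Schwartz function. -/
def modulatedGaussian {V : Type*} [NormedAddCommGroup V] [InnerProductSpace ℝ V] (N : V) :
    SchwartzMap V ℂ :=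
  SchwartzMap.smulLeftCLM ℂ (fun x : V => Complex.exp (Complex.I * (⟪N, x⟫ : ℝ)))
    ((schwartzGaussian V).postcompCLM Complex.ofRealCLM)

theorem modulatedGaussian_apply {V : Type*} [NormedAddCommGroup V] [InnerProductSpace ℝ V]
    (N x : V) : modulatedGaussian N x
      = Complex.exp (Complex.I * (⟪N, x⟫ : ℝ)) * Complex.exp (-(1 : ℂ) * ‖x‖ ^ 2) := by
  have hg : Function.HasTemperateGrowth fun x : V => Complex.exp (Complex.I * (⟪N, x⟫ : ℝ)) :=
    hasTemperateGrowth_cexp_I_mul.comp (Function.hasTemperateGrowth_inner_right N)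
  rw [modulatedGaussian, SchwartzMap.smulLeftCLM_apply_apply hg]
  simp [schwartzGaussian_apply]

/-- The short-time Fourier transform with the complex Gaussian window whose conjugate is
`exp (-a |t|²)`. -/
def gaussSTFT {n : ℕ} (a : ℂ) (f : EuclideanSpace ℝ (Fin n) → ℂ)
    (x ξ : EuclideanSpace ℝ (Fin n)) : ℂ :=
  ∫ t : EuclideanSpace ℝ (Fin n),
    Complex.exp (-(Complex.I * (⟪ξ, t⟫ : ℝ))) * Complex.exp (-a * ‖t - x‖ ^ 2) * f t

theorem conj_gauss {n : ℕ} (t : EuclideanSpace ℝ (Fin n)) :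
    (starRingEnd ℂ) (gauss t) = Complex.exp (-(1 : ℂ) * ‖t‖ ^ 2) := by
  rw [gauss, Complex.conj_ofReal]
  simp

theorem STFT_gauss {n : ℕ} (f : EuclideanSpace ℝ (Fin n) → ℂ) (x ξ : EuclideanSpace ℝ (Fin n)) :
    STFT gauss f x ξ = gaussSTFT 1 f x ξ := by
  simp only [STFT, gaussSTFT, conj_gauss]

theorem norm_cexp_neg_mul_sq_le {a : ℂ} (ha : 0 ≤ a.re) (r : ℝ) :
    ‖Complex.exp (-a * (r : ℂ) ^ 2)‖ ≤ 1 := by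
  rw [Complex.norm_exp, Real.exp_le_one_iff, ← Complex.ofReal_pow, Complex.re_mul_ofReal,
    Complex.neg_re]
  nlinarith [sq_nonneg r]

theorem continuous_gaussSTFT {n : ℕ} {a : ℂ} (ha : 0 ≤ a.re) {f : EuclideanSpace ℝ (Fin n) → ℂ}
    (hf : Integrable f) :
    Continuous fun z : EuclideanSpace ℝ (Fin n) × EuclideanSpace ℝ (Fin n) =>
      gaussSTFT a f z.1 z.2 := by
  refine continuous_of_dominated (bound := fun t => ‖f t‖) (fun z => ?_) (fun z => ?_) hf.norm ?_
  · exact (Continuous.aestronglyMeasurable (by fun_prop)).mul hf.aestronglyMeasurable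
  · refine .of_forall fun t => ?_
    rw [norm_mul, norm_mul]
    have h1 : ‖Complex.exp (-(Complex.I * (⟪z.2, t⟫ : ℝ)))‖ = 1 := by simp [Complex.norm_exp]
    rw [h1, one_mul]
    exact mul_le_of_le_one_left (norm_nonneg _) (norm_cexp_neg_mul_sq_le ha _)
  · exact .of_forall fun t => by fun_prop

theorem integrable_FT {n : ℕ} (f : SchwartzMap (EuclideanSpace ℝ (Fin n)) ℂ) :
    Integrable (FT ⇑f) := by
  have h : FT ⇑f = fun ξ => (FourierTransform.fourier f) ((2 * π)⁻¹ • ξ) := by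
    funext ξ
    rw [SchwartzMap.fourier_coe, Real.fourier_eq', FT]
    refine integral_congr_ae (.of_forall fun x => ?_)
    simp only [smul_eq_mul]
    congr 2
    rw [real_inner_smul_right, real_inner_comm]
    have : (π : ℂ) ≠ 0 := by exact_mod_cast Real.pi_ne_zero
    push_cast
    field_simp
  rw [h]
  exact (SchwartzMap.integrable _).comp_smul (by positivity)

/-- The short-time Fourier transform of a modulated Gaussian is a translate in frequency. -/
theorem gaussSTFT_modulatedGaussian {n : ℕ} (a : ℂ) (N x ξ : EuclideanSpace ℝ (Fin n)) :
    gaussSTFT a ⇑(modulatedGaussian N) x ξ = gaussSTFT a ⇑(modulatedGaussian 0) x (ξ - N) := by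
  refine integral_congr_ae (.of_forall fun t => ?_)
  simp only [modulatedGaussian_apply, ← Complex.exp_add, inner_sub_left, inner_zero_left]
  congr 1
  push_cast
  ring

theorem gaussSTFT_modulatedGaussian_zero {n : ℕ} (x ξ : EuclideanSpace ℝ (Fin n)) :
    ‖gaussSTFT 1 ⇑(modulatedGaussian 0) x ξ‖
      = ‖((π / 2 : ℂ) ^ (n / 2 : ℂ))‖ * (Real.exp (-2⁻¹ * ‖x‖ ^ 2) * Real.exp (-8⁻¹ * ‖ξ‖ ^ 2)) := by
  have h : gaussSTFT 1 ⇑(modulatedGaussian 0) x ξ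
      = Complex.exp (-(Complex.I * ((2⁻¹ * ⟪ξ, x⟫ : ℝ) : ℂ)) + ((-2⁻¹ * ‖x‖ ^ 2 : ℝ) : ℂ)) *
        ((π / 2 : ℂ) ^ (n / 2 : ℂ) * ((Real.exp (-8⁻¹ * ‖ξ‖ ^ 2) : ℝ) : ℂ)) := by
    have hg := GaussianFourier.integral_cexp_neg_mul_sq_norm_add
      (V := EuclideanSpace ℝ (Fin n)) (b := 2) (by norm_num) (-Complex.I) ξ
    rw [gaussSTFT, ← integral_add_right_eq_self _ ((2 : ℝ)⁻¹ • x)]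
    have e : ((π / 2 : ℂ) ^ (n / 2 : ℂ) * ((Real.exp (-8⁻¹ * ‖ξ‖ ^ 2) : ℝ) : ℂ)) =
        (π / 2 : ℂ) ^ (Module.finrank ℝ (EuclideanSpace ℝ (Fin n)) / 2 : ℂ) *
          Complex.exp ((-Complex.I) ^ 2 * ‖ξ‖ ^ 2 / (4 * 2)) := by
      rw [finrank_euclideanSpace_fin]
      congr 1
      rw [Complex.ofReal_exp]
      congr 1
      push_cast
      rw [neg_sq, Complex.I_sq]
      ring
    rw [e, ← hg, ← integral_const_mul]
    refine integral_congr_ae (.of_forall fun t => ?_)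
    simp only [modulatedGaussian_apply, ← Complex.exp_add, inner_zero_left]
    congr 1
    have h1 : ‖t + (2 : ℝ)⁻¹ • x - x‖ ^ 2 = ‖t‖ ^ 2 - ⟪t, x⟫ + 4⁻¹ * ‖x‖ ^ 2 := by
      have : t + (2 : ℝ)⁻¹ • x - x = t - (2 : ℝ)⁻¹ • x := by module
      rw [this, norm_sub_sq_real, real_inner_smul_right, norm_smul, mul_pow]
      norm_num
      ring
    have h2 : ‖t + (2 : ℝ)⁻¹ • x‖ ^ 2 = ‖t‖ ^ 2 + ⟪t, x⟫ + 4⁻¹ * ‖x‖ ^ 2 := by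
      rw [norm_add_sq_real, real_inner_smul_right, norm_smul, mul_pow]
      norm_num
      ring
    rw [← Complex.ofReal_pow, ← Complex.ofReal_pow, h1, h2, inner_add_right, real_inner_smul_right]
    push_cast
    ring
  rw [h, norm_mul, norm_mul, Complex.norm_exp, Complex.norm_real,
    Real.norm_of_nonneg (by positivity), Complex.add_re, Complex.ofReal_re, Complex.neg_re,
    Complex.I_mul_re, Complex.ofReal_im, neg_zero, neg_zero, zero_add]
  ring

theorem gaussSTFT_modulatedGaussian_zero_ne_zero {n : ℕ} {a : ℂ} (ha : 0 ≤ a.re) :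
    gaussSTFT a ⇑(modulatedGaussian (0 : EuclideanSpace ℝ (Fin n))) 0 0 ≠ 0 := by
  have hre : 0 < (a + 1).re := by simp; linarith
  have h := GaussianFourier.integral_cexp_neg_mul_sq_norm (V := EuclideanSpace ℝ (Fin n)) hre
  have e : gaussSTFT a ⇑(modulatedGaussian (0 : EuclideanSpace ℝ (Fin n))) 0 0 =
      ∫ v : EuclideanSpace ℝ (Fin n), Complex.exp (-(a + 1) * ‖v‖ ^ 2) := by
    refine integral_congr_ae (.of_forall fun t => ?_)
    simp only [modulatedGaussian_apply, ← Complex.exp_add, inner_zero_left, sub_zero]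
    congr 1
    push_cast
    ring
  rw [e, h]
  have h1 : (a + 1) ≠ 0 := fun h0 => by simp [h0] at hre
  have h2 : (π : ℂ) / (a + 1) ≠ 0 := div_ne_zero (by exact_mod_cast Real.pi_ne_zero) h1
  simp [Complex.cpow_eq_zero_iff, h2]

/-- A Gaussian as a superposition of time-frequency shifts of the Gaussian `exp (-‖u‖²)`. -/
theorem integral_gaussian_superposition {n : ℕ} {a b d : ℂ} (hb : 0 < b.re) (hd : 0 < d.re)
    (hab : b / (1 + b) + 1 / (4 * d) = a) (u : EuclideanSpace ℝ (Fin n)) :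
    ∫ w : EuclideanSpace ℝ (Fin n) × EuclideanSpace ℝ (Fin n),
      (Complex.exp (-b * ‖w.1‖ ^ 2) * Complex.exp (-(1 : ℂ) * ‖u - w.1‖ ^ 2)) *
        (Complex.exp (-d * ‖w.2‖ ^ 2) * Complex.exp (-(Complex.I * (⟪w.2, u⟫ : ℝ))))
      = (π / (1 + b)) ^ (n / 2 : ℂ) * (π / d) ^ (n / 2 : ℂ) * Complex.exp (-a * ‖u‖ ^ 2) := by
  have hb1 : 0 < (1 + b).re := by simp; linarith
  have hb0 : 1 + b ≠ 0 := fun h0 => by simp [h0] at hb1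
  have hd0 : d ≠ 0 := fun h0 => by simp [h0] at hd
  have h1 := GaussianFourier.integral_cexp_neg_mul_sq_norm_add hb1 2 u
  have h2 := GaussianFourier.integral_cexp_neg_mul_sq_norm_add hd (-Complex.I) u
  rw [finrank_euclideanSpace_fin] at h1 h2
  have e1 : ∫ y : EuclideanSpace ℝ (Fin n),
      Complex.exp (-b * ‖y‖ ^ 2) * Complex.exp (-(1 : ℂ) * ‖u - y‖ ^ 2)
      = (π / (1 + b)) ^ (n / 2 : ℂ) * Complex.exp (-(b / (1 + b)) * ‖u‖ ^ 2) := by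
    have : (π / (1 + b)) ^ (n / 2 : ℂ) * Complex.exp (-(b / (1 + b)) * ‖u‖ ^ 2)
        = Complex.exp (-(1 : ℂ) * ‖u‖ ^ 2) *
          ((π / (1 + b)) ^ (n / 2 : ℂ) * Complex.exp (2 ^ 2 * ‖u‖ ^ 2 / (4 * (1 + b)))) := by
      rw [mul_left_comm, ← Complex.exp_add]
      congr 2
      field_simp
      ring
    rw [this, ← h1, ← integral_const_mul]
    refine integral_congr_ae (.of_forall fun y => ?_)
    simp only [← Complex.exp_add]
    congr 1
    rw [← Complex.ofReal_pow ‖u - y‖, norm_sub_sq_real]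
    push_cast
    ring
  have e2 : ∫ y : EuclideanSpace ℝ (Fin n),
      Complex.exp (-d * ‖y‖ ^ 2) * Complex.exp (-(Complex.I * (⟪y, u⟫ : ℝ)))
      = (π / d) ^ (n / 2 : ℂ) * Complex.exp (-(1 / (4 * d)) * ‖u‖ ^ 2) := by
    have : Complex.exp (-(1 / (4 * d)) * ‖u‖ ^ 2)
        = Complex.exp ((-Complex.I) ^ 2 * ‖u‖ ^ 2 / (4 * d)) := by
      rw [neg_sq, Complex.I_sq]
      congr 1
      ring
    rw [this, ← h2]
    refine integral_congr_ae (.of_forall fun y => ?_)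
    simp only [← Complex.exp_add]
    rw [real_inner_comm]
    congr 1
    ring
  rw [Measure.volume_eq_prod]
  refine (integral_prod_mul (fun y : EuclideanSpace ℝ (Fin n) =>
      Complex.exp (-b * ‖y‖ ^ 2) * Complex.exp (-(1 : ℂ) * ‖u - y‖ ^ 2))
    (fun y : EuclideanSpace ℝ (Fin n) =>
      Complex.exp (-d * ‖y‖ ^ 2) * Complex.exp (-(Complex.I * (⟪y, u⟫ : ℝ))))).trans ?_
  rw [e1, e2, mul_mul_mul_comm, ← Complex.exp_add, ← hab]
  congr 2
  ring

/-- Change of window: a short-time Fourier transform with complex Gaussian window is dominated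
by the convolution of that with the real Gaussian window and an integrable function. -/
theorem exists_kernel_gaussSTFT_le {n : ℕ} {a b d : ℂ} (hb : 0 < b.re) (hd : 0 < d.re)
    (hab : b / (1 + b) + 1 / (4 * d) = a) :
    ∃ K : EuclideanSpace ℝ (Fin n) × EuclideanSpace ℝ (Fin n) → ℝ≥0∞, Measurable K ∧
      ∫⁻ w, K w ≠ ∞ ∧ ∀ f : EuclideanSpace ℝ (Fin n) → ℂ, Integrable f → ∀ x ξ,
        ‖gaussSTFT a f x ξ‖ₑ ≤ ∫⁻ w, K w * ‖gaussSTFT 1 f (x + w.1) (ξ + w.2)‖ₑ := by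
  set c : ℂ := (π / (1 + b)) ^ (n / 2 : ℂ) * (π / d) ^ (n / 2 : ℂ) with hc
  have hc0 : c ≠ 0 := by
    have hb1 : 0 < (1 + b).re := by simp; linarith
    have hb0 : 1 + b ≠ 0 := fun h0 => by simp [h0] at hb1
    have hd0 : d ≠ 0 := fun h0 => by simp [h0] at hd
    have hπ : (π : ℂ) ≠ 0 := by exact_mod_cast Real.pi_ne_zero
    refine mul_ne_zero ?_ ?_ <;> simp [Complex.cpow_eq_zero_iff, hb0, hd0, hπ]
  set h : EuclideanSpace ℝ (Fin n) × EuclideanSpace ℝ (Fin n) → ℂ := fun w =>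
    Complex.exp (-b * ‖w.1‖ ^ 2) * Complex.exp (-d * ‖w.2‖ ^ 2) with hh
  have hint : Integrable h :=
    (integrable_cexp_neg_mul_sq_norm hb).mul_prod (integrable_cexp_neg_mul_sq_norm hd)
  refine ⟨fun w => ‖c⁻¹ * h w‖ₑ, ?_, ?_, fun f hf x ξ => ?_⟩
  · exact Continuous.measurable (by fun_prop)
  · exact (hint.const_mul c⁻¹).hasFiniteIntegral.ne
  have key : gaussSTFT a f x ξ = ∫ w, c⁻¹ * h w *
      (Complex.exp (Complex.I * (⟪w.2, x⟫ : ℝ)) * gaussSTFT 1 f (x + w.1) (ξ + w.2)) := by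
    have hsw := integral_mul_integral_swap hf hint
      (φ := fun (t : EuclideanSpace ℝ (Fin n)) w => Complex.exp (-(Complex.I * (⟪ξ, t⟫ : ℝ))) *
        (Complex.exp (-(Complex.I * (⟪w.2, t - x⟫ : ℝ))) *
          Complex.exp (-(1 : ℂ) * ‖t - x - w.1‖ ^ 2))) (by fun_prop) (fun t w => by
        rw [norm_mul, norm_mul]
        have h1 (r : ℝ) : ‖Complex.exp (-(Complex.I * r))‖ = 1 := by simp [Complex.norm_exp]
        rw [h1, h1, one_mul, one_mul]
        exact norm_cexp_neg_mul_sq_le (by simp) _)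
    have e1 (t : EuclideanSpace ℝ (Fin n)) :
        ∫ w, Complex.exp (-(Complex.I * (⟪ξ, t⟫ : ℝ))) *
          (Complex.exp (-(Complex.I * (⟪w.2, t - x⟫ : ℝ))) *
            Complex.exp (-(1 : ℂ) * ‖t - x - w.1‖ ^ 2)) * h w
        = c * (Complex.exp (-(Complex.I * (⟪ξ, t⟫ : ℝ))) * Complex.exp (-a * ‖t - x‖ ^ 2)) := by
      rw [mul_left_comm, hc, ← integral_gaussian_superposition hb hd hab, ← integral_const_mul]
      refine integral_congr_ae (.of_forall fun w => ?_)
      simp only [hh]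
      ring
    have e2 (w : EuclideanSpace ℝ (Fin n) × EuclideanSpace ℝ (Fin n)) :
        ∫ t, Complex.exp (-(Complex.I * (⟪ξ, t⟫ : ℝ))) *
          (Complex.exp (-(Complex.I * (⟪w.2, t - x⟫ : ℝ))) *
            Complex.exp (-(1 : ℂ) * ‖t - x - w.1‖ ^ 2)) * f t
        = Complex.exp (Complex.I * (⟪w.2, x⟫ : ℝ)) * gaussSTFT 1 f (x + w.1) (ξ + w.2) := by
      rw [gaussSTFT, ← integral_const_mul]
      refine integral_congr_ae (.of_forall fun t => ?_)
      simp only [← mul_assoc, ← Complex.exp_add, sub_sub, inner_sub_right, inner_add_left]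
      congr 2
      push_cast
      ring
    simp only [e1, e2] at hsw
    simp_rw [mul_assoc]
    rw [integral_const_mul, ← hsw, ← integral_const_mul]
    refine integral_congr_ae (.of_forall fun t => ?_)
    field_simp
  rw [key]
  refine (enorm_integral_le_lintegral_enorm _).trans_eq (lintegral_congr fun w => ?_)
  have h1 : ‖Complex.exp (Complex.I * (⟪w.2, x⟫ : ℝ))‖ₑ = 1 := by
    rw [← ofReal_norm]
    simp [Complex.norm_exp]
  rw [enorm_mul, enorm_mul (Complex.exp _), h1, one_mul]

theorem integral_cexp_mul_gaussian_shift {n : ℕ} (x ξ η : EuclideanSpace ℝ (Fin n)) :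
    ∫ t : EuclideanSpace ℝ (Fin n), Complex.exp (-(Complex.I * (⟪ξ, t⟫ : ℝ))) *
        Complex.exp (Complex.I * (⟪t, η⟫ : ℝ)) * Complex.exp (-(1 : ℂ) * ‖t - x‖ ^ 2)
      = (π : ℂ) ^ (n / 2 : ℂ) * (Complex.exp (Complex.I * (⟪η - ξ, x⟫ : ℝ)) *
          Complex.exp (-(4⁻¹ : ℂ) * ‖η - ξ‖ ^ 2)) := by
  have h := GaussianFourier.integral_cexp_neg_mul_sq_norm_add
    (V := EuclideanSpace ℝ (Fin n)) (b := 1) (by simp) Complex.I (η - ξ)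
  rw [finrank_euclideanSpace_fin, div_one, Complex.I_sq] at h
  have e : Complex.exp (-(4⁻¹ : ℂ) * ‖η - ξ‖ ^ 2)
      = Complex.exp (-1 * ‖η - ξ‖ ^ 2 / (4 * 1)) := by
    congr 1
    ring
  rw [e, mul_left_comm, ← h, ← integral_add_right_eq_self _ x, ← integral_const_mul]
  refine integral_congr_ae (.of_forall fun t => ?_)
  simp only [← Complex.exp_add, add_sub_cancel_right, inner_add_right, inner_add_left,
    inner_sub_left]
  rw [real_inner_comm t η, real_inner_comm x η]
  congr 1
  push_cast
  ring

theorem integral_chirp_mul_gaussian_shift {n : ℕ} (x ξ t : EuclideanSpace ℝ (Fin n)) :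
    ∫ η : EuclideanSpace ℝ (Fin n), (Complex.exp (-(Complex.I * ((‖η‖ ^ 2 : ℝ) : ℂ))) *
        (Complex.exp (Complex.I * (⟪η - ξ, x⟫ : ℝ)) *
          Complex.exp (-(Complex.I * (⟪η, t⟫ : ℝ))))) *
            Complex.exp (-(4⁻¹ : ℂ) * ‖η - ξ‖ ^ 2)
      = (π / (4⁻¹ + Complex.I)) ^ (n / 2 : ℂ) *
          Complex.exp (-(Complex.I * ((‖ξ‖ ^ 2 : ℝ) : ℂ))) *
          (Complex.exp (-(Complex.I * (⟪ξ, t⟫ : ℝ))) *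
            Complex.exp (-(1 / (1 + 4 * Complex.I)) * ‖t - (x - (2 : ℝ) • ξ)‖ ^ 2)) := by
  have hb : 0 < (4⁻¹ + Complex.I : ℂ).re := by norm_num
  have h := GaussianFourier.integral_cexp_neg_mul_sq_norm_add
    (V := EuclideanSpace ℝ (Fin n)) hb (-Complex.I) (t - (x - (2 : ℝ) • ξ))
  rw [finrank_euclideanSpace_fin, neg_sq, Complex.I_sq] at h
  have h0 : (4⁻¹ + Complex.I : ℂ) ≠ 0 := fun h0 => by simp [h0] at hb
  have h1 : (1 + 4 * Complex.I : ℂ) ≠ 0 := fun h1 => h0 (by linear_combination h1 / 4)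
  have e : Complex.exp (-(1 / (1 + 4 * Complex.I)) * ‖t - (x - (2 : ℝ) • ξ)‖ ^ 2)
      = Complex.exp (-1 * ‖t - (x - (2 : ℝ) • ξ)‖ ^ 2 / (4 * (4⁻¹ + Complex.I))) := by
    have h4 : (4 * (4⁻¹ + Complex.I) : ℂ) = 1 + 4 * Complex.I := by ring
    rw [h4]
    congr 1
    ring
  have assoc (A X Y G : ℂ) : A * X * (Y * G) = X * Y * (A * G) := by ring
  rw [e, assoc, ← h, ← integral_add_right_eq_self _ ξ, ← integral_const_mul]
  refine integral_congr_ae (.of_forall fun ζ => ?_)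
  simp only [← Complex.exp_add, add_sub_cancel_right, inner_add_left, inner_sub_left,
    real_inner_smul_left]
  rw [norm_add_sq_real, real_inner_comm ζ t, real_inner_comm ζ x, real_inner_comm ζ ξ]
  congr 1
  push_cast
  ring

/-- The Schrödinger propagator acts on the Gaussian short-time Fourier transform as the shear
`x ↦ x - 2ξ`, up to a change of window. -/
theorem exists_norm_STFT_schrod_eq (n : ℕ) :
    ∃ c : ℝ, 0 < c ∧ ∀ (f : SchwartzMap (EuclideanSpace ℝ (Fin n)) ℂ)
      (x ξ : EuclideanSpace ℝ (Fin n)), ‖STFT gauss (schrod 1 ⇑f) x ξ‖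
        = c * ‖gaussSTFT (1 / (1 + 4 * Complex.I)) ⇑f (x - (2 : ℝ) • ξ) ξ‖ := by
  set q : ℂ := ((((2 * Real.pi) ^ n)⁻¹ : ℝ) : ℂ) with hq
  have hπ : (π : ℂ) ≠ 0 := by exact_mod_cast Real.pi_ne_zero
  have h0 : (4⁻¹ + Complex.I : ℂ) ≠ 0 := fun h0 => by
    have := congrArg Complex.re h0
    norm_num at this
  have norm_one (r : ℝ) : ‖Complex.exp (Complex.I * r)‖ = 1 := by simp [Complex.norm_exp]
  have norm_one' (r : ℝ) : ‖Complex.exp (-(Complex.I * r))‖ = 1 := by simp [Complex.norm_exp]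
  refine ⟨‖q * (π : ℂ) ^ (n / 2 : ℂ) * (π / (4⁻¹ + Complex.I)) ^ (n / 2 : ℂ)‖, ?_,
    fun f x ξ => ?_⟩
  · rw [norm_pos_iff]
    refine mul_ne_zero (mul_ne_zero ?_ ?_) ?_
    · rw [hq, Complex.ofReal_ne_zero]
      positivity
    · simp [Complex.cpow_eq_zero_iff, hπ]
    · simp [Complex.cpow_eq_zero_iff, hπ, h0]
  have hh : Integrable fun η : EuclideanSpace ℝ (Fin n) =>
      Complex.exp (-(Complex.I * ((‖η‖ ^ 2 : ℝ) : ℂ))) * FT ⇑f η :=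
    (integrable_FT f).bdd_mul (c := 1) (Continuous.aestronglyMeasurable (by fun_prop))
      (.of_forall fun η => (norm_one' _).le)
  have hG : Integrable fun t : EuclideanSpace ℝ (Fin n) =>
      Complex.exp (-(1 : ℂ) * ‖t - x‖ ^ 2) :=
    (integrable_cexp_neg_mul_sq_norm (b := 1) (by simp)).comp_sub_right x
  have hk : Integrable fun η : EuclideanSpace ℝ (Fin n) =>
      Complex.exp (-(4⁻¹ : ℂ) * ‖η - ξ‖ ^ 2) :=
    (integrable_cexp_neg_mul_sq_norm (b := 4⁻¹) (by norm_num)).comp_sub_right ξ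
  have swap1 := integral_mul_integral_swap hG hh
    (φ := fun t η => Complex.exp (-(Complex.I * (⟪ξ, t⟫ : ℝ))) *
      Complex.exp (Complex.I * (⟪t, η⟫ : ℝ))) (by fun_prop)
    (fun t η => by rw [norm_mul, norm_one, norm_one', one_mul])
  have swap2 := integral_mul_integral_swap hk (f.integrable (μ := volume))
    (φ := fun η t => Complex.exp (-(Complex.I * ((‖η‖ ^ 2 : ℝ) : ℂ))) *
        (Complex.exp (Complex.I * (⟪η - ξ, x⟫ : ℝ)) *
          Complex.exp (-(Complex.I * (⟪η, t⟫ : ℝ))))) (by fun_prop)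
    (fun η t => by rw [norm_mul, norm_mul, norm_one, norm_one', norm_one', one_mul, one_mul])
  simp only [integral_cexp_mul_gaussian_shift] at swap1
  simp only [integral_chirp_mul_gaussian_shift] at swap2
  have key : gaussSTFT 1 (schrod 1 ⇑f) x ξ
      = q * (π : ℂ) ^ (n / 2 : ℂ) * (π / (4⁻¹ + Complex.I)) ^ (n / 2 : ℂ) *
        (Complex.exp (-(Complex.I * ((‖ξ‖ ^ 2 : ℝ) : ℂ))) *
          gaussSTFT (1 / (1 + 4 * Complex.I)) ⇑f (x - (2 : ℝ) • ξ) ξ) := by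
    have s1 : gaussSTFT 1 (schrod 1 ⇑f) x ξ = q * ∫ t : EuclideanSpace ℝ (Fin n),
        Complex.exp (-(1 : ℂ) * ‖t - x‖ ^ 2) * ∫ η : EuclideanSpace ℝ (Fin n),
          Complex.exp (-(Complex.I * (⟪ξ, t⟫ : ℝ))) * Complex.exp (Complex.I * (⟪t, η⟫ : ℝ)) *
            (Complex.exp (-(Complex.I * ((‖η‖ ^ 2 : ℝ) : ℂ))) * FT ⇑f η) := by
      rw [gaussSTFT, ← integral_const_mul]
      refine integral_congr_ae (.of_forall fun t => ?_)
      simp only [schrod, mul_assoc]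
      rw [integral_const_mul, Complex.ofReal_one]
      simp only [one_mul]
      ring
    have s2 : ∫ η : EuclideanSpace ℝ (Fin n),
        Complex.exp (-(Complex.I * ((‖η‖ ^ 2 : ℝ) : ℂ))) * FT ⇑f η *
          ((π : ℂ) ^ (n / 2 : ℂ) * (Complex.exp (Complex.I * (⟪η - ξ, x⟫ : ℝ)) *
            Complex.exp (-(4⁻¹ : ℂ) * ‖η - ξ‖ ^ 2)))
        = (π : ℂ) ^ (n / 2 : ℂ) * ∫ η : EuclideanSpace ℝ (Fin n),
          Complex.exp (-(4⁻¹ : ℂ) * ‖η - ξ‖ ^ 2) * ∫ t : EuclideanSpace ℝ (Fin n),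
            Complex.exp (-(Complex.I * ((‖η‖ ^ 2 : ℝ) : ℂ))) *
              (Complex.exp (Complex.I * (⟪η - ξ, x⟫ : ℝ)) *
                Complex.exp (-(Complex.I * (⟪η, t⟫ : ℝ)))) * f t := by
      rw [← integral_const_mul]
      refine integral_congr_ae (.of_forall fun η => ?_)
      simp only [FT, mul_assoc]
      rw [integral_const_mul, integral_const_mul]
      ring
    rw [s1, swap1, s2, swap2, gaussSTFT]
    simp only [mul_assoc]
    congr 2
    simp only [← integral_const_mul]
    refine integral_congr_ae (.of_forall fun t => ?_)
    simp only
    ring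
  rw [STFT_gauss, key, norm_mul, norm_mul (Complex.exp _), norm_one', one_mul]

theorem eLpNorm_const_mul_ennreal {α : Type*} [MeasurableSpace α] {μ : Measure α} {p : ℝ≥0∞}
    (hp : 1 ≤ p) {c : ℝ≥0∞} (hc : c ≠ ∞) (F : α → ℝ≥0∞) :
    eLpNorm (fun x => c * F x) p μ = c * eLpNorm F p μ := by
  by_cases h : p = ∞
  · subst h
    simp only [eLpNorm_exponent_top, eLpNormEssSup, enorm_eq_self]
    exact ENNReal.essSup_const_mul
  · have hp0 : 0 < p.toReal := ENNReal.toReal_pos (by positivity) h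
    rw [eLpNorm_eq_lintegral_rpow_enorm_toReal (by positivity) h,
      eLpNorm_eq_lintegral_rpow_enorm_toReal (by positivity) h]
    simp only [enorm_eq_self, one_div, ENNReal.mul_rpow_of_nonneg _ _ hp0.le]
    rw [lintegral_const_mul' _ _ (ENNReal.rpow_ne_top_of_nonneg hp0.le hc),
      ENNReal.mul_rpow_of_nonneg _ _ (by positivity), ENNReal.rpow_rpow_inv hp0.ne']

theorem continuous_jp {n : ℕ} (s : ℝ) : Continuous (jp s : EuclideanSpace ℝ (Fin n) → ℝ) :=
  Continuous.rpow_const (by fun_prop) fun x => .inl (by positivity)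

theorem WNorm_eq_eLpNorm {n : ℕ} (s : ℝ) {p : ℝ≥0∞} (hp : 1 ≤ p)
    {f : EuclideanSpace ℝ (Fin n) → ℂ} (hf : Integrable f) :
    WNorm s p p f = eLpNorm (fun z : EuclideanSpace ℝ (Fin n) × EuclideanSpace ℝ (Fin n) =>
      ENNReal.ofReal (jp s z.2) * ‖gaussSTFT 1 f z.1 z.2‖ₑ) p volume := by
  rw [← lpN_lpN_eq_eLpNorm_prod hp]
  · simp only [WNorm, STFT_gauss]
    rfl
  · exact ((continuous_jp s).measurable.comp measurable_snd).ennreal_ofReal.mul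
      (continuous_gaussSTFT (by simp) hf).measurable.enorm

theorem measurePreserving_shear (n : ℕ) :
    MeasurePreserving (fun z : EuclideanSpace ℝ (Fin n) × EuclideanSpace ℝ (Fin n) =>
      (z.1 - (2 : ℝ) • z.2, z.2)) := by
  have h := MeasurePreserving.skew_product (μa := (volume : Measure (EuclideanSpace ℝ (Fin n))))
    (μc := (volume : Measure (EuclideanSpace ℝ (Fin n))))
    (MeasurePreserving.id volume) (g := fun ξ x => x - (2 : ℝ) • ξ)
    (by fun_prop)
    (.of_forall fun ξ => (measurePreserving_sub_right volume ((2 : ℝ) • ξ)).map_eq)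
  exact (Measure.measurePreserving_swap.comp h).comp Measure.measurePreserving_swap

theorem re_one_div_one_add_four_mul_I_nonneg : 0 ≤ (1 / (1 + 4 * Complex.I) : ℂ).re := by
  rw [one_div, Complex.inv_re]
  exact div_nonneg (by simp) (Complex.normSq_nonneg _)

theorem exists_WNorm_schrod_eq (n : ℕ) :
    ∃ c : ℝ, 0 < c ∧ ∀ (p : ℝ≥0∞), 1 ≤ p → ∀ f : SchwartzMap (EuclideanSpace ℝ (Fin n)) ℂ,
      WNorm 0 p p (schrod 1 ⇑f) = ENNReal.ofReal c *
        eLpNorm (fun z : EuclideanSpace ℝ (Fin n) × EuclideanSpace ℝ (Fin n) =>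
          ‖gaussSTFT (1 / (1 + 4 * Complex.I)) ⇑f z.1 z.2‖ₑ) p volume := by
  obtain ⟨c, hc, h⟩ := exists_norm_STFT_schrod_eq n
  refine ⟨c, hc, fun p hp f => ?_⟩
  have ha := re_one_div_one_add_four_mul_I_nonneg
  have hm : Measurable fun z : EuclideanSpace ℝ (Fin n) × EuclideanSpace ℝ (Fin n) =>
      ‖gaussSTFT (1 / (1 + 4 * Complex.I)) ⇑f z.1 z.2‖ₑ :=
    (continuous_gaussSTFT ha f.integrable).measurable.enorm
  rw [← eLpNorm_comp_measurePreserving hm.aestronglyMeasurable (measurePreserving_shear n),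
    ← eLpNorm_const_mul_ennreal hp ENNReal.ofReal_ne_top, ← lpN_lpN_eq_eLpNorm_prod hp]
  · simp only [WNorm, jp, zero_div, Real.rpow_zero, ENNReal.ofReal_one, one_mul]
    congr! 4 with x ξ
    change ‖STFT gauss (schrod 1 ⇑f) x ξ‖ₑ = _
    rw [← ofReal_norm, h, ENNReal.ofReal_mul hc.le, ofReal_norm]
    rfl
  · exact (hm.comp (measurePreserving_shear n).measurable).const_mul _

theorem schrod_bounded_of_nonneg {n : ℕ} {s : ℝ} (hs : 0 ≤ s) {p : ℝ≥0∞} (hp : 1 ≤ p) :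
    ∃ C : ℝ, 0 < C ∧ ∀ f : SchwartzMap (EuclideanSpace ℝ (Fin n)) ℂ,
      WNorm 0 p p (schrod 1 ⇑f) ≤ ENNReal.ofReal C * WNorm s p p ⇑f := by
  obtain ⟨c, hc, hW⟩ := exists_WNorm_schrod_eq n
  obtain ⟨K, hK, hKi, hle⟩ := exists_kernel_gaussSTFT_le (n := n) (a := 1 / (1 + 4 * Complex.I))
    (b := 33⁻¹) (d := 17 / 130 * (1 + 8 * Complex.I)) (by norm_num) (by norm_num) (by
      have h1 : (1 + 4 * Complex.I : ℂ) ≠ 0 := fun h => by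
        simpa using congrArg Complex.re h
      have h2 : (1 + 8 * Complex.I : ℂ) ≠ 0 := fun h => by
        simpa using congrArg Complex.re h
      field_simp
      ring_nf
      rw [Complex.I_sq]
      ring)
  refine ⟨c * ((∫⁻ w, K w).toReal + 1), by positivity, fun f => ?_⟩
  have hm : Measurable fun z : EuclideanSpace ℝ (Fin n) × EuclideanSpace ℝ (Fin n) =>
      ‖gaussSTFT 1 ⇑f z.1 z.2‖ₑ :=
    (continuous_gaussSTFT (by simp) f.integrable).measurable.enorm
  have : (volume : Measure (EuclideanSpace ℝ (Fin n) ×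
      EuclideanSpace ℝ (Fin n))).IsAddLeftInvariant := by
    rw [Measure.volume_eq_prod]
    infer_instance
  rw [hW p hp f, WNorm_eq_eLpNorm s hp f.integrable, ENNReal.ofReal_mul hc.le, mul_assoc]
  gcongr
  calc _ ≤ eLpNorm (fun z : EuclideanSpace ℝ (Fin n) × EuclideanSpace ℝ (Fin n) =>
          ∫⁻ w, K w * ‖gaussSTFT 1 ⇑f (z + w).1 (z + w).2‖ₑ) p volume :=
        eLpNorm_mono_enorm fun z => hle f f.integrable z.1 z.2
    _ ≤ (∫⁻ w, K w) * eLpNorm (fun z : EuclideanSpace ℝ (Fin n) × EuclideanSpace ℝ (Fin n) =>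
          ‖gaussSTFT 1 ⇑f z.1 z.2‖ₑ) p volume :=
        eLpNorm_lintegral_mul_add_le volume hK hm hp
    _ ≤ _ := by
      gcongr
      · rw [ENNReal.le_ofReal_iff_toReal_le hKi (by positivity)]
        linarith
      · refine eLpNorm_mono_enorm fun z => ?_
        simp only [enorm_eq_self]
        refine le_mul_of_one_le_left' ?_
        rw [ENNReal.one_le_ofReal]
        exact Real.one_le_rpow (by nlinarith [sq_nonneg ‖z.2‖]) (by positivity)

theorem jp_le_mul_jp {n : ℕ} {s : ℝ} (hs : s ≤ 0) (N ξ : EuclideanSpace ℝ (Fin n)) :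
    jp s ξ ≤ 2 ^ (-s / 2) * jp s N * jp (-s) (ξ - N) := by
  have h : 1 + ‖N‖ ^ 2 ≤ 2 * (1 + ‖ξ - N‖ ^ 2) * (1 + ‖ξ‖ ^ 2) := by
    have h1 : ‖N‖ ≤ ‖ξ‖ + ‖ξ - N‖ := by
      simpa using norm_sub_le ξ (ξ - N)
    nlinarith [norm_nonneg N, norm_nonneg ξ, norm_nonneg (ξ - N), sq_nonneg (‖ξ‖ - ‖ξ - N‖),
      mul_nonneg (sq_nonneg ‖ξ‖) (sq_nonneg ‖ξ - N‖)]
  have h2 : (1 + ‖N‖ ^ 2) ^ (-s / 2)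
      ≤ 2 ^ (-s / 2) * jp (-s) (ξ - N) * (1 + ‖ξ‖ ^ 2) ^ (-s / 2) := by
    unfold jp
    rw [← Real.mul_rpow (by positivity) (by positivity),
      ← Real.mul_rpow (by positivity) (by positivity)]
    exact Real.rpow_le_rpow (by positivity) h (by linarith)
  have e (x : EuclideanSpace ℝ (Fin n)) : jp s x * (1 + ‖x‖ ^ 2) ^ (-s / 2) = 1 := by
    rw [jp, ← Real.rpow_add (by positivity)]
    simp [neg_div]
  have hj (x : EuclideanSpace ℝ (Fin n)) : 0 ≤ jp s x := by unfold jp; positivity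
  calc jp s ξ = jp s ξ * jp s N * (1 + ‖N‖ ^ 2) ^ (-s / 2) := by rw [mul_assoc, e, mul_one]
    _ ≤ jp s ξ * jp s N * (2 ^ (-s / 2) * jp (-s) (ξ - N) * (1 + ‖ξ‖ ^ 2) ^ (-s / 2)) := by
      have := mul_nonneg (hj ξ) (hj N)
      gcongr
    _ = 2 ^ (-s / 2) * jp s N * jp (-s) (ξ - N) * (jp s ξ * (1 + ‖ξ‖ ^ 2) ^ (-s / 2)) := by ring
    _ = _ := by rw [e, mul_one]

theorem eLpNorm_gaussian_prod_lt_top {n : ℕ} {p : ℝ≥0∞} (hp : 1 ≤ p) {b c : ℝ} (hb : 0 < b)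
    (hc : 0 < c) : eLpNorm (fun z : EuclideanSpace ℝ (Fin n) × EuclideanSpace ℝ (Fin n) =>
      ENNReal.ofReal (Real.exp (-b * ‖z.1‖ ^ 2) * Real.exp (-c * ‖z.2‖ ^ 2))) p volume < ∞ := by
  by_cases h : p = ∞
  · subst h
    simp only [eLpNorm_exponent_top, eLpNormEssSup, enorm_eq_self]
    refine (essSup_le_of_ae_le 1 (.of_forall fun z => ?_)).trans_lt ENNReal.one_lt_top
    simp only [ENNReal.ofReal_le_one]
    exact mul_le_one₀ (Real.exp_le_one_iff.2 (by nlinarith [sq_nonneg ‖z.1‖])) (by positivity)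
      (Real.exp_le_one_iff.2 (by nlinarith [sq_nonneg ‖z.2‖]))
  · have hp0 : 0 < p.toReal := ENNReal.toReal_pos (by positivity) h
    have hint {b : ℝ} (hb : 0 < b) : Integrable fun x : EuclideanSpace ℝ (Fin n) =>
        Real.exp (p.toReal * (-b * ‖x‖ ^ 2)) := by
      have hg := (integrable_cexp_neg_mul_sq_norm (V := EuclideanSpace ℝ (Fin n))
        (b := ((p.toReal * b : ℝ) : ℂ)) (by simpa using mul_pos hp0 hb)).norm
      refine hg.congr (.of_forall fun x => ?_)
      simp only [Complex.norm_exp]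
      congr 1
      rw [← Complex.ofReal_pow, Complex.re_mul_ofReal, Complex.neg_re, Complex.ofReal_re]
      ring
    rw [eLpNorm_eq_lintegral_rpow_enorm_toReal (by positivity) h]
    refine ENNReal.rpow_lt_top_of_nonneg (by positivity) (LT.lt.ne ?_)
    refine lt_of_eq_of_lt (lintegral_congr fun z => ?_)
      ((hint hb).mul_prod (hint hc)).lintegral_lt_top
    rw [enorm_eq_self, ENNReal.ofReal_rpow_of_nonneg (by positivity) hp0.le, ← Real.exp_add,
      ← Real.exp_add, ← Real.exp_mul]
    congr 2
    ring

theorem exists_jp_mul_gaussian_le {n : ℕ} {m : ℝ} (hm : 0 ≤ m) :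
    ∃ B : ℝ, 0 ≤ B ∧ ∀ ξ : EuclideanSpace ℝ (Fin n),
      jp m ξ * Real.exp (-8⁻¹ * ‖ξ‖ ^ 2) ≤ B * Real.exp (-16⁻¹ * ‖ξ‖ ^ 2) := by
  set L : ℝ := 16 * (m / 2 + 1) with hL
  have hL1 : 1 ≤ L := by linarith
  refine ⟨L ^ (m / 2), by positivity, fun ξ => ?_⟩
  have h1 : 1 + ‖ξ‖ ^ 2 ≤ L * Real.exp (‖ξ‖ ^ 2 / L) := by
    have h := Real.add_one_le_exp (‖ξ‖ ^ 2 / L)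
    calc 1 + ‖ξ‖ ^ 2 ≤ L * (‖ξ‖ ^ 2 / L + 1) := by
          field_simp
          linarith
      _ ≤ _ := by gcongr
  have h2 : jp m ξ ≤ L ^ (m / 2) * Real.exp (16⁻¹ * ‖ξ‖ ^ 2) := by
    refine (Real.rpow_le_rpow (by positivity) h1 (by positivity)).trans ?_
    rw [Real.mul_rpow (by positivity) (by positivity), ← Real.exp_mul]
    refine mul_le_mul_of_nonneg_left (Real.exp_le_exp.2 ?_) (by positivity)
    rw [div_mul_eq_mul_div, div_le_iff₀ (by positivity), hL]
    nlinarith [sq_nonneg ‖ξ‖]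
  calc _ ≤ L ^ (m / 2) * Real.exp (16⁻¹ * ‖ξ‖ ^ 2) * Real.exp (-8⁻¹ * ‖ξ‖ ^ 2) := by gcongr
    _ = _ := by
      rw [mul_assoc, ← Real.exp_add]
      congr 2
      ring

theorem eLpNorm_jp_mul_gaussSTFT_gaussian_lt_top {n : ℕ} {m : ℝ} (hm : 0 ≤ m) {p : ℝ≥0∞}
    (hp : 1 ≤ p) : eLpNorm (fun z : EuclideanSpace ℝ (Fin n) × EuclideanSpace ℝ (Fin n) =>
      ENNReal.ofReal (jp m z.2) * ‖gaussSTFT 1 ⇑(modulatedGaussian 0) z.1 z.2‖ₑ) p volume < ∞ := by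
  obtain ⟨B, hB0, hB⟩ := exists_jp_mul_gaussian_le (n := n) hm
  set A : ℝ := ‖((π / 2 : ℂ) ^ (n / 2 : ℂ))‖ with hA
  have hle : eLpNorm (fun z : EuclideanSpace ℝ (Fin n) × EuclideanSpace ℝ (Fin n) =>
      ENNReal.ofReal (jp m z.2) * ‖gaussSTFT 1 ⇑(modulatedGaussian 0) z.1 z.2‖ₑ) p volume
      ≤ ENNReal.ofReal (A * B) *
        eLpNorm (fun z : EuclideanSpace ℝ (Fin n) × EuclideanSpace ℝ (Fin n) =>
          ENNReal.ofReal (Real.exp (-2⁻¹ * ‖z.1‖ ^ 2) * Real.exp (-16⁻¹ * ‖z.2‖ ^ 2)))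
            p volume := by
    rw [← eLpNorm_const_mul_ennreal hp ENNReal.ofReal_ne_top]
    refine eLpNorm_mono_enorm fun z => ?_
    simp only [enorm_eq_self]
    rw [← ofReal_norm, gaussSTFT_modulatedGaussian_zero,
      ← ENNReal.ofReal_mul (by unfold jp; positivity), ← ENNReal.ofReal_mul (by positivity), ← hA]
    refine ENNReal.ofReal_le_ofReal ?_
    calc _ = A * Real.exp (-2⁻¹ * ‖z.1‖ ^ 2) * (jp m z.2 * Real.exp (-8⁻¹ * ‖z.2‖ ^ 2)) := by ring
      _ ≤ A * Real.exp (-2⁻¹ * ‖z.1‖ ^ 2) * (B * Real.exp (-16⁻¹ * ‖z.2‖ ^ 2)) := by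
        exact mul_le_mul_of_nonneg_left (hB z.2) (by positivity)
      _ = _ := by ring
  exact hle.trans_lt (ENNReal.mul_lt_top ENNReal.ofReal_lt_top
    (eLpNorm_gaussian_prod_lt_top hp (by norm_num) (by norm_num)))

theorem eLpNorm_gaussSTFT_gaussian_ne_zero {n : ℕ} {a : ℂ} (ha : 0 ≤ a.re) {p : ℝ≥0∞}
    (hp : 1 ≤ p) : eLpNorm (fun z : EuclideanSpace ℝ (Fin n) × EuclideanSpace ℝ (Fin n) =>
      ‖gaussSTFT a ⇑(modulatedGaussian 0) z.1 z.2‖ₑ) p volume ≠ 0 := by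
  have hcont := continuous_gaussSTFT ha
    (modulatedGaussian (0 : EuclideanSpace ℝ (Fin n))).integrable
  intro h0
  have h1 : eLpNorm (fun z : EuclideanSpace ℝ (Fin n) × EuclideanSpace ℝ (Fin n) =>
      gaussSTFT a ⇑(modulatedGaussian 0) z.1 z.2) p volume = 0 := by
    rw [← h0]
    exact (eLpNorm_enorm _).symm
  rw [eLpNorm_eq_zero_iff hcont.aestronglyMeasurable (by positivity),
    Measure.volume_eq_prod] at h1
  have h2 := (hcont.ae_eq_iff_eq _ continuous_zero).1 h1
  exact gaussSTFT_modulatedGaussian_zero_ne_zero ha (congrFun h2 (0, 0))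

theorem measurePreserving_sub_snd {n : ℕ} (N : EuclideanSpace ℝ (Fin n)) :
    MeasurePreserving (fun z : EuclideanSpace ℝ (Fin n) × EuclideanSpace ℝ (Fin n) =>
      (z.1, z.2 - N)) :=
  (MeasurePreserving.id (volume : Measure (EuclideanSpace ℝ (Fin n)))).prod
    (measurePreserving_sub_right volume N)

theorem eLpNorm_gaussSTFT_modulatedGaussian {n : ℕ} {a : ℂ} (ha : 0 ≤ a.re) (p : ℝ≥0∞)
    (N : EuclideanSpace ℝ (Fin n)) :
    eLpNorm (fun z : EuclideanSpace ℝ (Fin n) × EuclideanSpace ℝ (Fin n) =>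
      ‖gaussSTFT a ⇑(modulatedGaussian N) z.1 z.2‖ₑ) p volume =
    eLpNorm (fun z : EuclideanSpace ℝ (Fin n) × EuclideanSpace ℝ (Fin n) =>
      ‖gaussSTFT a ⇑(modulatedGaussian 0) z.1 z.2‖ₑ) p volume := by
  rw [← eLpNorm_comp_measurePreserving (continuous_gaussSTFT ha
    (modulatedGaussian 0).integrable).measurable.enorm.aestronglyMeasurable
      (measurePreserving_sub_snd N)]
  simp only [gaussSTFT_modulatedGaussian a N]
  rfl

theorem WNorm_modulatedGaussian_le {n : ℕ} {s : ℝ} (hs : s ≤ 0) {p : ℝ≥0∞} (hp : 1 ≤ p)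
    (N : EuclideanSpace ℝ (Fin n)) :
    WNorm s p p ⇑(modulatedGaussian N) ≤ ENNReal.ofReal (2 ^ (-s / 2) * jp s N) *
      eLpNorm (fun z : EuclideanSpace ℝ (Fin n) × EuclideanSpace ℝ (Fin n) =>
        ENNReal.ofReal (jp (-s) z.2) * ‖gaussSTFT 1 ⇑(modulatedGaussian 0) z.1 z.2‖ₑ)
          p volume := by
  have hm : Measurable fun z : EuclideanSpace ℝ (Fin n) × EuclideanSpace ℝ (Fin n) =>
      ENNReal.ofReal (jp (-s) z.2) * ‖gaussSTFT 1 ⇑(modulatedGaussian 0) z.1 z.2‖ₑ :=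
    ((continuous_jp (-s)).measurable.comp measurable_snd).ennreal_ofReal.mul
      (continuous_gaussSTFT (by simp) (modulatedGaussian 0).integrable).measurable.enorm
  rw [WNorm_eq_eLpNorm s hp (modulatedGaussian N).integrable,
    ← eLpNorm_comp_measurePreserving hm.aestronglyMeasurable (measurePreserving_sub_snd N),
    ← eLpNorm_const_mul_ennreal hp ENNReal.ofReal_ne_top]
  refine eLpNorm_mono_enorm fun z => ?_
  simp only [enorm_eq_self, Function.comp_apply, gaussSTFT_modulatedGaussian 1 N]
  rw [← mul_assoc, ← ENNReal.ofReal_mul (by unfold jp; positivity)]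
  gcongr
  exact jp_le_mul_jp hs N z.2

theorem tendsto_jp_smul_atTop {n : ℕ} {s : ℝ} (hs : s < 0) {e : EuclideanSpace ℝ (Fin n)}
    (he : ‖e‖ = 1) : Filter.Tendsto (fun R : ℝ => jp s (R • e)) Filter.atTop (nhds 0) := by
  have h1 : Filter.Tendsto (fun R : ℝ => 1 + R ^ 2) Filter.atTop Filter.atTop :=
    Filter.tendsto_atTop_add_const_left _ _ (Filter.tendsto_pow_atTop two_ne_zero)
  have h2 := (tendsto_rpow_neg_atTop (y := -(s / 2)) (by linarith)).comp h1
  refine h2.congr fun R => ?_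
  simp [jp, norm_smul, he]

theorem nonneg_of_schrod_bounded {n : ℕ} (hn : 1 ≤ n) {s : ℝ} {p : ℝ≥0∞} (hp : 1 ≤ p) {C : ℝ}
    (h : ∀ f : SchwartzMap (EuclideanSpace ℝ (Fin n)) ℂ,
      WNorm 0 p p (schrod 1 ⇑f) ≤ ENNReal.ofReal C * WNorm s p p ⇑f) : 0 ≤ s := by
  by_contra! hs
  obtain ⟨c, hc, hW⟩ := exists_WNorm_schrod_eq n
  have ha := re_one_div_one_add_four_mul_I_nonneg
  set B := eLpNorm (fun z : EuclideanSpace ℝ (Fin n) × EuclideanSpace ℝ (Fin n) =>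
    ‖gaussSTFT (1 / (1 + 4 * Complex.I)) ⇑(modulatedGaussian 0) z.1 z.2‖ₑ) p volume with hB
  set A := eLpNorm (fun z : EuclideanSpace ℝ (Fin n) × EuclideanSpace ℝ (Fin n) =>
    ENNReal.ofReal (jp (-s) z.2) * ‖gaussSTFT 1 ⇑(modulatedGaussian 0) z.1 z.2‖ₑ) p volume
  have hA : A < ∞ := eLpNorm_jp_mul_gaussSTFT_gaussian_lt_top (by linarith) hp
  have hB0 : B ≠ 0 := eLpNorm_gaussSTFT_gaussian_ne_zero ha hp
  let e : EuclideanSpace ℝ (Fin n) := EuclideanSpace.single ⟨0, hn⟩ 1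
  have hle (R : ℝ) : ENNReal.ofReal c * B ≤
      ENNReal.ofReal C * (ENNReal.ofReal (2 ^ (-s / 2) * jp s (R • e)) * A) := by
    have h1 := h (modulatedGaussian (R • e))
    rw [hW p hp, eLpNorm_gaussSTFT_modulatedGaussian ha, ← hB] at h1
    refine h1.trans ?_
    gcongr
    exact WNorm_modulatedGaussian_le hs.le hp _
  have hlim : Filter.Tendsto (fun R : ℝ => ENNReal.ofReal C *
      (ENNReal.ofReal (2 ^ (-s / 2) * jp s (R • e)) * A)) Filter.atTop (nhds 0) := by
    have h1 := ENNReal.tendsto_ofReal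
      ((tendsto_jp_smul_atTop hs (e := e) (by simp [e])).const_mul (2 ^ (-s / 2)))
    have h2 := ENNReal.Tendsto.const_mul (a := ENNReal.ofReal C)
      (ENNReal.Tendsto.mul_const (b := A) h1 (.inr hA.ne)) (.inr ENNReal.ofReal_ne_top)
    simpa using h2
  have h0 := ge_of_tendsto' hlim hle
  have : ENNReal.ofReal c * B = 0 := le_antisymm h0 bot_le
  simp [hB0, hc.not_ge] at this

/-- For `n ≥ 1`, `s ∈ ℝ`, `1 ≤ p ≤ ∞`, the Schrödinger operator `e^{iΔ}` is bounded from
`W^s_{p,p}` to `W_{p,p}` (on Schwartz functions) if and only if `s ≥ 0`. -/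
theorem schrodinger_wiener_diagonal_bounded_iff (n : ℕ) (hn : 1 ≤ n) (s : ℝ) (p : ℝ≥0∞)
    (hp : 1 ≤ p) :
    (∃ C : ℝ, 0 < C ∧ ∀ f : SchwartzMap (EuclideanSpace ℝ (Fin n)) ℂ,
      WNorm 0 p p (schrod 1 ⇑f) ≤ ENNReal.ofReal C * WNorm s p p ⇑f) ↔ 0 ≤ s := by
  refine ⟨fun ⟨C, _, h⟩ => nonneg_of_schrod_bounded hn hp h,
    fun hs => schrod_bounded_of_nonneg hs hp⟩

end
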